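/- For every integer n ≥ 1, the q-Narayana polynomial at t = 1 equals the q-Catalan number: (1/[n]) ∑_{j=0}^{n−1} q^{j²+j} [n choose j]_q [n choose j+1]_q = (1/[n+1]) [2n choose n]_q in ℚ(q). -/

import Mathlib

open Finset

/-- The field `ℚ(q)` of rational functions. -/
noncomputable abbrev K : Type := RatFunc ℚ

/-- The indeterminate `q`, viewed in `ℚ(q)`. -/
noncomputable def q : K := RatFunc.X

/-- `[n] = (1 - q^n)/(1 - q)` in `ℚ(q)`. -/
noncomputable def qint (n : ℕ) : K := (1 - q ^ n) / (1 - q)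

/-- The Gaussian binomial coefficient `[n choose k]_q` in `ℚ(q)`. -/
noncomputable def qbinom (n k : ℤ) : K :=
  if 0 ≤ k ∧ k ≤ n then
    ∏ i ∈ Finset.range k.toNat, (1 - q ^ (n - k + (i : ℤ) + 1)) / (1 - q ^ ((i : ℤ) + 1))
  else if k = 0 then 1 else 0

theorem q_ne_zero : q ≠ 0 := RatFunc.X_ne_zero

theorem one_sub_q_pow_succ_ne_zero (n : ℕ) : 1 - q ^ (n + 1) ≠ 0 := by
  have h : (1 : K) - q ^ (n + 1) =
      algebraMap (Polynomial ℚ) K (-(Polynomial.X ^ (n + 1) - Polynomial.C 1)) := by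
    simp [q]
  rw [h]
  exact RatFunc.algebraMap_ne_zero
    (neg_ne_zero.mpr (Polynomial.X_pow_sub_C_ne_zero (Nat.succ_pos n) 1))

/-- The `q`-Pochhammer symbol `(q; q)_n = (1 - q)(1 - q^2)⋯(1 - q^n)`. -/
noncomputable def qPochhammer (n : ℕ) : K := ∏ i ∈ range n, (1 - q ^ (i + 1))

theorem qPochhammer_zero : qPochhammer 0 = 1 := prod_range_zero _

theorem qPochhammer_succ (n : ℕ) :
    qPochhammer (n + 1) = qPochhammer n * (1 - q ^ (n + 1)) := prod_range_succ _ _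

theorem qPochhammer_ne_zero (n : ℕ) : qPochhammer n ≠ 0 :=
  prod_ne_zero_iff.mpr fun i _ => one_sub_q_pow_succ_ne_zero i

theorem qbinom_eq_div {n a b : ℕ} (h : a + b = n) :
    qbinom n a = qPochhammer n / (qPochhammer a * qPochhammer b) := by
  subst h
  have hb : qPochhammer (a + b) = qPochhammer b * ∏ i ∈ range a, (1 - q ^ (b + i + 1)) := by
    rw [add_comm, qPochhammer, prod_range_add, qPochhammer]
  rw [qbinom, if_pos (by constructor <;> push_cast <;> omega), Int.toNat_natCast,
    prod_div_distrib, hb, mul_comm (qPochhammer a), mul_div_mul_left _ _ (qPochhammer_ne_zero b)]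
  congr 1
  refine prod_congr rfl fun i _ => ?_
  rw [← zpow_natCast]
  congr 2
  push_cast
  ring

theorem qbinom_eq_zero_of_lt {n k : ℕ} (h : n < k) : qbinom n k = 0 := by
  rw [qbinom, if_neg (by omega), if_neg (by omega)]

theorem qbinom_zero_right (n : ℕ) : qbinom n (0 : ℕ) = 1 := by
  rw [qbinom_eq_div (zero_add n), qPochhammer_zero, one_mul, div_self (qPochhammer_ne_zero n)]

theorem qbinom_self (n : ℕ) : qbinom n n = 1 := by
  rw [qbinom_eq_div (add_zero n), qPochhammer_zero, mul_one, div_self (qPochhammer_ne_zero n)]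

theorem qbinom_symm {n a b : ℕ} (h : a + b = n) : qbinom n a = qbinom n b := by
  rw [qbinom_eq_div h, qbinom_eq_div ((add_comm b a).trans h), mul_comm (qPochhammer a)]

theorem qbinom_succ_succ (n k : ℕ) :
    qbinom (n + 1 : ℕ) (k + 1 : ℕ) = qbinom n k + q ^ (k + 1) * qbinom n (k + 1 : ℕ) := by
  rcases lt_trichotomy n k with h | rfl | h
  · rw [qbinom_eq_zero_of_lt h, qbinom_eq_zero_of_lt (by omega : n < k + 1),
      qbinom_eq_zero_of_lt (by omega : n + 1 < k + 1)]
    ring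
  · rw [qbinom_self, qbinom_self, qbinom_eq_zero_of_lt n.lt_succ_self]
    ring
  · obtain ⟨d, rfl⟩ := Nat.exists_eq_add_of_lt h
    rw [qbinom_eq_div (by omega : k + 1 + (d + 1) = k + d + 1 + 1),
      qbinom_eq_div (by omega : k + (d + 1) = k + d + 1),
      qbinom_eq_div (by omega : k + 1 + d = k + d + 1),
      qPochhammer_succ (k + d + 1), qPochhammer_succ k, qPochhammer_succ d]
    have hk := qPochhammer_ne_zero k
    have hd := qPochhammer_ne_zero d
    have hk' := one_sub_q_pow_succ_ne_zero k
    have hd' := one_sub_q_pow_succ_ne_zero d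
    field_simp
    ring

theorem qbinom_succ_succ' (n k : ℕ) :
    qbinom (n + 1 : ℕ) (k + 1 : ℕ) =
      qbinom n (k + 1 : ℕ) + q ^ ((n : ℤ) - k) * qbinom n k := by
  rcases lt_trichotomy n k with h | rfl | h
  · rw [qbinom_eq_zero_of_lt h, qbinom_eq_zero_of_lt (by omega : n < k + 1),
      qbinom_eq_zero_of_lt (by omega : n + 1 < k + 1)]
    ring
  · rw [qbinom_self, qbinom_self, qbinom_eq_zero_of_lt n.lt_succ_self, sub_self, zpow_zero]
    ring
  · obtain ⟨d, rfl⟩ := Nat.exists_eq_add_of_lt h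
    rw [qbinom_symm (by omega : k + 1 + (d + 1) = k + d + 1 + 1), qbinom_succ_succ,
      qbinom_symm (by omega : d + (k + 1) = k + d + 1),
      qbinom_symm (by omega : d + 1 + k = k + d + 1), ← zpow_natCast]
    congr 3
    push_cast
    ring

/-- The `q`-Vandermonde identity. -/
theorem qbinom_add_eq_sum_antidiagonal (m n k : ℕ) :
    qbinom (m + n : ℕ) k = ∑ p ∈ antidiagonal k,
      q ^ (((m : ℤ) - p.1) * p.2) * qbinom m p.1 * qbinom n p.2 := by
  induction n generalizing m with
  | zero =>
    rw [sum_eq_single (k, 0)]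
    · simp only [add_zero, Nat.cast_zero, mul_zero, zpow_zero, one_mul]
      rw [← Nat.cast_zero, qbinom_self, mul_one]
    · rintro ⟨i, j⟩ hp hne
      have hj : 0 < j := by
        rcases Nat.eq_zero_or_pos j with rfl | hj
        · simp_all
        · exact hj
      rw [qbinom_eq_zero_of_lt hj, mul_zero]
    · simp
  | succ n ih =>
    rw [show m + (n + 1) = m + 1 + n by ring, ih]
    cases k with
    | zero =>
      simp only [Nat.antidiagonal_zero, sum_singleton, qbinom_zero_right]
      simp
    | succ k =>
      have hL := Nat.sum_antidiagonal_succ (n := k)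
        (f := fun p => q ^ (((m + 1 : ℕ) - p.1 : ℤ) * p.2) * qbinom (m + 1 : ℕ) p.1 * qbinom n p.2)
      have hR := Nat.sum_antidiagonal_succ' (n := k)
        (f := fun p => q ^ (((m : ℤ) - p.1) * p.2) * qbinom m p.1 * qbinom (n + 1 : ℕ) p.2)
      have hM := Nat.sum_antidiagonal_succ (n := k)
        (f := fun p => q ^ (((m + 1 : ℕ) - p.1 : ℤ) * p.2) * qbinom m p.1 * qbinom n p.2)
      have hM' := Nat.sum_antidiagonal_succ' (n := k)
        (f := fun p => q ^ (((m + 1 : ℕ) - p.1 : ℤ) * p.2) * qbinom m p.1 * qbinom n p.2)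
      simp only at hL hR hM hM'
      rw [hM] at hM'
      rw [hL, hR]
      simp only [qbinom_succ_succ n, qbinom_succ_succ' m, mul_add, add_mul, sum_add_distrib,
        qbinom_zero_right] at hM' ⊢
      have h₁ : ∀ p : ℕ × ℕ, q ^ (((m + 1 : ℕ) - (p.1 + 1 : ℕ) : ℤ) * p.2) *
          (q ^ ((m : ℤ) - p.1) * qbinom m p.1) * qbinom n p.2 =
          q ^ (((m : ℤ) - p.1) * (p.2 + 1 : ℕ)) * qbinom m p.1 * qbinom n p.2 := by
        intro p
        rw [← mul_assoc, ← zpow_add₀ q_ne_zero]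
        congr 3
        push_cast
        ring
      have h₂ : ∀ p : ℕ × ℕ, q ^ (((m : ℤ) - p.1) * (p.2 + 1 : ℕ)) * qbinom m p.1 *
          (q ^ (p.2 + 1) * qbinom n (p.2 + 1 : ℕ)) =
          q ^ (((m + 1 : ℕ) - p.1 : ℤ) * (p.2 + 1 : ℕ)) * qbinom m p.1 *
            qbinom n (p.2 + 1 : ℕ) := by
        intro p
        rw [← zpow_natCast q (p.2 + 1), mul_mul_mul_comm, ← mul_assoc,
          ← zpow_add₀ q_ne_zero]
        congr 3
        push_cast
        ring
      simp only [h₁, h₂]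
      simp only [Nat.cast_zero, mul_zero, zpow_zero] at hM' ⊢
      linear_combination hM'

/-- The q-Narayana polynomial at `t = 1` is the q-Catalan number:
`(1/[n]) ∑_{j=0}^{n−1} q^{j²+j} [n choose j][n choose j+1] = (1/[n+1]) [2n choose n]`. -/
theorem qNarayana_one_eq_qCatalan (n : ℕ) (hn : 1 ≤ n) :
    (1 / qint n) * ∑ j ∈ Finset.range n, q ^ (j ^ 2 + j) * qbinom n j * qbinom n ((j : ℤ) + 1) =
      (1 / qint (n + 1)) * qbinom (2 * n) n := by
  obtain ⟨n, rfl⟩ := Nat.exists_eq_add_of_le' hn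
  have hsum : ∑ j ∈ range (n + 1), q ^ (j ^ 2 + j) * qbinom (n + 1 : ℕ) j *
      qbinom (n + 1 : ℕ) ((j : ℤ) + 1) = qbinom (n + 1 + (n + 1) : ℕ) n := by
    rw [qbinom_add_eq_sum_antidiagonal, ← Nat.sum_antidiagonal_swap,
      Nat.sum_antidiagonal_eq_sum_range_succ_mk]
    refine sum_congr rfl fun j hj => ?_
    have hj : j ≤ n := Nat.lt_succ_iff.mp (mem_range.mp hj)
    simp only [Prod.fst_swap, Prod.snd_swap]
    rw [qbinom_symm (by omega : n - j + (j + 1) = n + 1), ← zpow_natCast, mul_right_comm]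
    push_cast [hj]
    congr 3
    ring
  rw [hsum, show (2 * (n + 1 : ℕ) : ℤ) = (n + 1 + (n + 1) : ℕ) by push_cast; ring,
    qbinom_eq_div (by omega : n + (n + 2) = n + 1 + (n + 1)), qbinom_eq_div rfl,
    qPochhammer_succ (n + 1), qPochhammer_succ n, qint, qint]
  have h₀ := qPochhammer_ne_zero n
  have h₁ : 1 - q ≠ 0 := by simpa using one_sub_q_pow_succ_ne_zero 0
  have h₂ := one_sub_q_pow_succ_ne_zero n
  have h₃ := one_sub_q_pow_succ_ne_zero (n + 1)
  field_simp
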